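/- Let K ≥ 2, N ≥ 2, F_s > 0, and for k = 1,…,K let z_k = e^{−d_k} e^{2πi f_k/F_s} with d_k ≥ 0 and f_k ∈ [0, F_s) pairwise distinct. Set d_max = max_{1≤k≤K} d_k and let δ be the minimum wrap-around distance between the frequencies f_k. If d_max < 1/(N−1) and δ > 84 F_s / (π (N−1)(1 − d_max(N−1))), then the condition number of the Vandermonde matrix V_N ∈ ℂ^{N×K} satisfies κ(V_N) ≤ √( (N−1 + 84 F_s/(π δ)) / ( (N−1)(1 − d_max(N−1)) − 84 F_s/(π δ) ) ); equivalently, for all unit vectors u, v ∈ ℂ^K, ‖V_N v‖₂² ≤ [ (N−1 + 84 F_s/(π δ)) / ( (N−1)(1 − d_max(N−1)) − 84 F_s/(π δ) ) ] ‖V_N u‖₂². -/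

import Mathlib

open scoped BigOperators

/-- Euclidean (ℓ²) norm of a complex vector. -/
noncomputable def enorm2 {n : ℕ} (v : Fin n → ℂ) : ℝ := Real.sqrt (∑ i, ‖v i‖ ^ 2)

/-- Vandermonde matrix with nodes `z`, `L` rows: entry `(n, k)` is `z k ^ n`. -/
def vand {K : ℕ} (z : Fin K → ℂ) (L : ℕ) : Matrix (Fin L) (Fin K) ℂ :=
  Matrix.of fun n k => z k ^ (n : ℕ)

open ComplexConjugate in
/-- The off-diagonal part of the sesquilinear form with kernel `G (z k * conj (z l))`. -/
noncomputable def offDiagForm {ι : Type*} [Fintype ι] [DecidableEq ι]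
    (z : ι → ℂ) (G : ℂ → ℂ) (a : ι → ℂ) : ℂ :=
  ∑ k, ∑ l, if k = l then 0 else a k * conj (a l) * G (z k * conj (z l))

section OffDiagForm

open ComplexConjugate

variable {ι : Type*} [Fintype ι] [DecidableEq ι] {z : ι → ℂ}

lemma offDiagForm_congr {G H : ℂ → ℂ}
    (h : ∀ k l, k ≠ l → G (z k * conj (z l)) = H (z k * conj (z l))) (a : ι → ℂ) :
    offDiagForm z G a = offDiagForm z H a := by
  unfold offDiagForm
  refine Finset.sum_congr rfl fun k _ => Finset.sum_congr rfl fun l _ => ?_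
  split_ifs with hkl
  · rfl
  · rw [h k l hkl]

lemma offDiagForm_add (G H : ℂ → ℂ) (a : ι → ℂ) :
    offDiagForm z (fun w => G w + H w) a = offDiagForm z G a + offDiagForm z H a := by
  unfold offDiagForm
  simp only [← Finset.sum_add_distrib]
  refine Finset.sum_congr rfl fun k _ => Finset.sum_congr rfl fun l _ => ?_
  split_ifs <;> ring

lemma offDiagForm_const_mul (c : ℂ) (G : ℂ → ℂ) (a : ι → ℂ) :
    offDiagForm z (fun w => c * G w) a = c * offDiagForm z G a := by
  unfold offDiagForm
  simp only [Finset.mul_sum]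
  refine Finset.sum_congr rfl fun k _ => Finset.sum_congr rfl fun l _ => ?_
  split_ifs <;> ring

lemma offDiagForm_mul_pow (N : ℕ) (G : ℂ → ℂ) (a : ι → ℂ) :
    offDiagForm z G (fun k => a k * z k ^ N) = offDiagForm z (fun w => w ^ N * G w) a := by
  unfold offDiagForm
  refine Finset.sum_congr rfl fun k _ => Finset.sum_congr rfl fun l _ => ?_
  split_ifs
  · rfl
  · simp only [map_mul, map_pow, mul_pow]
    ring

/-- A sum of squared moduli of exponential sums splits into its diagonal and off-diagonal part. -/
lemma sum_norm_sq_eq_diag_add_offDiagForm {σ : Type*} (s : Finset σ) (e : σ → ℕ) (a : ι → ℂ) :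
    ∑ j ∈ s, ‖∑ k, a k * z k ^ e j‖ ^ 2 =
      ∑ k, ‖a k‖ ^ 2 * ∑ j ∈ s, (‖z k‖ ^ 2) ^ e j +
        (offDiagForm z (fun w => ∑ j ∈ s, w ^ e j) a).re := by
  have key : ((∑ j ∈ s, ‖∑ k, a k * z k ^ e j‖ ^ 2 : ℝ) : ℂ) =
      ((∑ k, ‖a k‖ ^ 2 * ∑ j ∈ s, (‖z k‖ ^ 2) ^ e j : ℝ) : ℂ) +
        offDiagForm z (fun w => ∑ j ∈ s, w ^ e j) a := by
    have h1 : ((∑ j ∈ s, ‖∑ k, a k * z k ^ e j‖ ^ 2 : ℝ) : ℂ) =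
        ∑ k, ∑ l, a k * conj (a l) * ∑ j ∈ s, (z k * conj (z l)) ^ e j := by
      push_cast
      simp_rw [← Complex.mul_conj', map_sum, Finset.sum_mul_sum, Finset.mul_sum]
      rw [Finset.sum_comm]
      refine Finset.sum_congr rfl fun k _ => ?_
      rw [Finset.sum_comm]
      refine Finset.sum_congr rfl fun l _ => Finset.sum_congr rfl fun j _ => ?_
      simp only [map_mul, map_pow, mul_pow]
      ring
    rw [h1]
    unfold offDiagForm
    push_cast
    rw [← Finset.sum_add_distrib]
    refine Finset.sum_congr rfl fun k _ => ?_
    rw [← Finset.add_sum_erase _ _ (Finset.mem_univ k),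
      ← Finset.add_sum_erase (a := k) _ (fun l => if k = l then (0 : ℂ) else _)
        (Finset.mem_univ k)]
    simp only [if_true, zero_add]
    congr 1
    · simp_rw [← Complex.mul_conj']
    · refine Finset.sum_congr rfl fun l hl => ?_
      rw [if_neg (Finset.ne_of_mem_erase hl).symm]
  have := congrArg Complex.re key
  simpa only [Complex.add_re, Complex.ofReal_re] using this

/-- Schur test for the off-diagonal form with a kernel dominated by `‖1 - w‖⁻²`. -/
lemma norm_offDiagForm_le {S C : ℝ} (hC : 0 ≤ C)
    (hS : ∀ k, ∑ l, (if k = l then 0 else (‖1 - z k * conj (z l)‖ ^ 2)⁻¹) ≤ S) {G : ℂ → ℂ}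
    (hG : ∀ k l, k ≠ l →
      ‖G (z k * conj (z l))‖ ≤ C * (‖1 - z k * conj (z l)‖ ^ 2)⁻¹) (a : ι → ℂ) :
    ‖offDiagForm z G a‖ ≤ C * S * ∑ k, ‖a k‖ ^ 2 := by
  set h : ι → ι → ℝ := fun k l => if k = l then 0 else (‖1 - z k * conj (z l)‖ ^ 2)⁻¹ with hh
  have hsymm : ∀ k l, h k l = h l k := by
    intro k l
    have : ‖1 - z k * conj (z l)‖ = ‖1 - z l * conj (z k)‖ := by
      rw [← Complex.norm_conj]
      congr 1
      simp [mul_comm]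
    simp only [hh, this, eq_comm (a := k)]
  have hnn : ∀ k l, 0 ≤ h k l := by
    intro k l
    simp only [hh]
    split_ifs <;> positivity
  calc ‖offDiagForm z G a‖
      ≤ ∑ k, ∑ l, C * ((‖a k‖ ^ 2 + ‖a l‖ ^ 2) / 2 * h k l) := by
        refine (norm_sum_le _ _).trans (Finset.sum_le_sum fun k _ => ?_)
        refine (norm_sum_le _ _).trans (Finset.sum_le_sum fun l _ => ?_)
        by_cases hkl : k = l
        · simp [hh, hkl]
        · have h1 := hG k l hkl
          have h2 : ‖a k‖ * ‖a l‖ ≤ (‖a k‖ ^ 2 + ‖a l‖ ^ 2) / 2 := by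
            nlinarith [sq_nonneg (‖a k‖ - ‖a l‖)]
          have h3 : h k l = (‖1 - z k * conj (z l)‖ ^ 2)⁻¹ := by simp [hh, hkl]
          rw [if_neg hkl, norm_mul, norm_mul, Complex.norm_conj]
          rw [← h3] at h1
          calc ‖a k‖ * ‖a l‖ * ‖G (z k * conj (z l))‖
              ≤ (‖a k‖ ^ 2 + ‖a l‖ ^ 2) / 2 * (C * h k l) := by gcongr
            _ = _ := by ring
    _ = C * ∑ k, ‖a k‖ ^ 2 * ∑ l, h k l := by
        have e1 : ∑ k, ∑ l, ‖a l‖ ^ 2 * h k l = ∑ k, ∑ l, ‖a k‖ ^ 2 * h k l := by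
          rw [Finset.sum_comm]
          simp_rw [hsymm]
        have e2 : ∑ k, ∑ l, C * ((‖a k‖ ^ 2 + ‖a l‖ ^ 2) / 2 * h k l) =
            C / 2 * ∑ k, ∑ l, ‖a k‖ ^ 2 * h k l + C / 2 * ∑ k, ∑ l, ‖a l‖ ^ 2 * h k l := by
          simp only [Finset.mul_sum, ← Finset.sum_add_distrib]
          refine Finset.sum_congr rfl fun k _ => Finset.sum_congr rfl fun l _ => ?_
          ring
        rw [e2, e1]
        simp only [← Finset.mul_sum]
        ring
    _ ≤ C * ∑ k, ‖a k‖ ^ 2 * S := by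
        gcongr with k
        exact hS k
    _ = _ := by rw [← Finset.sum_mul]; ring


lemma sum_sum_range_succ_pow {w : ℂ} (hw : w ≠ 1) (L : ℕ) :
    ∑ i ∈ Finset.range L, ∑ n ∈ Finset.range (i + 1), w ^ n =
      L * (1 - w)⁻¹ + -(w * (1 - w ^ L) * ((1 - w) ^ 2)⁻¹) := by
  have h : 1 - w ≠ 0 := sub_ne_zero.2 hw.symm
  induction L with
  | zero => simp
  | succ L ih =>
    rw [Finset.sum_range_succ, ih, geom_sum_eq hw, ← neg_sub w 1]
    have h' : w - 1 ≠ 0 := sub_ne_zero.2 hw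
    push_cast
    field_simp
    ring

lemma norm_one_sub_pow_le {w : ℂ} (hw : ‖w‖ ≤ 1) (n : ℕ) : ‖1 - w ^ n‖ ≤ 2 := by
  refine (norm_sub_le _ _).trans ?_
  have : ‖w ^ n‖ ≤ 1 := by
    rw [norm_pow]
    exact pow_le_one₀ (norm_nonneg _) hw
  rw [norm_one]
  linarith

/-- A large sieve inequality for triangular weights, with nodes in the closed unit disk. -/
lemma sum_sum_range_succ_norm_sq_le {S E : ℝ} {L : ℕ}
    (hz0 : ∀ k, z k ≠ 0) (hz1 : ∀ k, ‖z k‖ ≤ 1)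
    (hE : ∀ k, 1 ≤ E * (‖z k‖ ^ (L - 1)) ^ 2)
    (hS0 : 0 ≤ S) (hne : ∀ k l, k ≠ l → z k * conj (z l) ≠ 1)
    (hS : ∀ k, ∑ l, (if k = l then 0 else (‖1 - z k * conj (z l)‖ ^ 2)⁻¹) ≤ S) (a : ι → ℂ) :
    ∑ i ∈ Finset.range L, ∑ n ∈ Finset.range (i + 1), ‖∑ k, a k * z k ^ n‖ ^ 2 ≤
      (L ^ 2 + 4 * S) * E * ∑ k, ‖a k‖ ^ 2 := by
  have hw : ∀ k l, ‖z k * conj (z l)‖ ≤ 1 := fun k l => by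
    rw [norm_mul, Complex.norm_conj]
    exact mul_le_one₀ (hz1 k) (norm_nonneg _) (hz1 l)
  set b : ι → ℂ := fun k => a k * (z k ^ (L - 1))⁻¹ with hb
  have hba : ∀ n, ∑ k, a k * z k ^ n = ∑ k, b k * z k ^ (L - 1 + n) := by
    intro n
    refine Finset.sum_congr rfl fun k _ => ?_
    have := pow_ne_zero (L - 1) (hz0 k)
    simp only [hb, pow_add]
    field_simp
  have hbn : ∑ k, ‖b k‖ ^ 2 ≤ E * ∑ k, ‖a k‖ ^ 2 := by
    rw [Finset.mul_sum]
    refine Finset.sum_le_sum fun k _ => ?_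
    have hpos : 0 < (‖z k‖ ^ (L - 1)) ^ 2 := by
      have := norm_pos_iff.2 (hz0 k)
      positivity
    simp only [hb, norm_mul, norm_inv, norm_pow, mul_pow, inv_pow]
    rw [mul_comm E]
    gcongr
    rw [inv_le_iff_one_le_mul₀ hpos]
    exact hE k
  have hmaj : ∑ i ∈ Finset.range L, ∑ n ∈ Finset.range (i + 1), ‖∑ k, a k * z k ^ n‖ ^ 2 ≤
      ∑ i ∈ Finset.range L, ∑ m ∈ Finset.range L, ‖∑ k, b k * z k ^ (i + m)‖ ^ 2 := by
    refine Finset.sum_le_sum fun i hi => ?_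
    rw [Finset.mem_range] at hi
    have himg : ∑ n ∈ Finset.range (i + 1), ‖∑ k, a k * z k ^ n‖ ^ 2 =
        ∑ m ∈ (Finset.range (i + 1)).image (fun n => L - 1 - i + n),
          ‖∑ k, b k * z k ^ (i + m)‖ ^ 2 := by
      rw [Finset.sum_image (by intro x _ y _ h; simpa using h)]
      refine Finset.sum_congr rfl fun n _ => ?_
      rw [hba, show i + (L - 1 - i + n) = L - 1 + n by omega]
    rw [himg]
    refine Finset.sum_le_sum_of_subset_of_nonneg ?_ fun _ _ _ => by positivity
    intro m hm
    simp only [Finset.mem_image, Finset.mem_range] at hm ⊢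
    omega
  rw [← Finset.sum_product', sum_norm_sq_eq_diag_add_offDiagForm] at hmaj
  have hdiag : ∑ k, ‖b k‖ ^ 2 * ∑ j ∈ Finset.range L ×ˢ Finset.range L,
      (‖z k‖ ^ 2) ^ (j.1 + j.2) ≤ L ^ 2 * ∑ k, ‖b k‖ ^ 2 := by
    rw [Finset.mul_sum]
    refine Finset.sum_le_sum fun k _ => ?_
    rw [mul_comm]
    gcongr
    refine (Finset.sum_le_card_nsmul _ _ 1 fun j _ =>
      pow_le_one₀ (by positivity) (pow_le_one₀ (norm_nonneg _) (hz1 k))).trans_eq ?_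
    simp [sq]
  have hoff := norm_offDiagForm_le (G := fun w => ∑ j ∈ Finset.range L ×ˢ Finset.range L,
    w ^ (j.1 + j.2)) (C := 4) (by norm_num) hS (fun k l hkl => by
      have hw1 := hne k l hkl
      set w := z k * conj (z l)
      have h4 := norm_one_sub_pow_le (hw k l) L
      have : ∑ j ∈ Finset.range L ×ˢ Finset.range L, w ^ (j.1 + j.2) =
          (1 - w ^ L) ^ 2 * ((1 - w) ^ 2)⁻¹ := by
        simp_rw [pow_add]
        rw [Finset.sum_product, ← Finset.sum_mul_sum, geom_sum_eq hw1, ← neg_sub 1 (w ^ L),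
          ← neg_sub 1 w, neg_div_neg_eq, ← sq, div_pow, div_eq_mul_inv]
      rw [this, norm_mul, norm_inv, norm_pow, norm_pow]
      gcongr
      nlinarith [norm_nonneg (1 - w ^ L)]) b
  have hre := (Complex.re_le_norm _).trans hoff
  calc _ ≤ _ := hmaj
    _ ≤ (L ^ 2 + 4 * S) * ∑ k, ‖b k‖ ^ 2 := by linarith
    _ ≤ (L ^ 2 + 4 * S) * (E * ∑ k, ‖a k‖ ^ 2) := by gcongr
    _ = _ := by ring

lemma offDiagForm_inv_one_sub_bounds {S E : ℝ} {L : ℕ}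
    (hz0 : ∀ k, z k ≠ 0) (hz1 : ∀ k, ‖z k‖ ≤ 1)
    (hE : ∀ k, 1 ≤ E * (‖z k‖ ^ (L - 1)) ^ 2)
    (hS0 : 0 ≤ S) (hne : ∀ k l, k ≠ l → z k * conj (z l) ≠ 1)
    (hS : ∀ k, ∑ l, (if k = l then 0 else (‖1 - z k * conj (z l)‖ ^ 2)⁻¹) ≤ S) (a : ι → ℂ) :
    L * (offDiagForm z (fun w => (1 - w)⁻¹) a).re ≤
        ((L ^ 2 + 4 * S) * E + 2 * S) * ∑ k, ‖a k‖ ^ 2 ∧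
      -((L ^ 2 + 2 * S) * ∑ k, ‖a k‖ ^ 2) ≤
        L * (offDiagForm z (fun w => (1 - w)⁻¹) a).re := by
  have hT := sum_sum_range_succ_norm_sq_le hz0 hz1 hE hS0 hne hS a
  have hT0 : 0 ≤ ∑ i ∈ Finset.range L, ∑ n ∈ Finset.range (i + 1), ‖∑ k, a k * z k ^ n‖ ^ 2 := by
    positivity
  rw [Finset.sum_sigma', sum_norm_sq_eq_diag_add_offDiagForm (z := z)
    ((Finset.range L).sigma fun i => Finset.range (i + 1)) (fun j => j.2)] at hT hT0
  set R : ℂ → ℂ := fun w => -(w * (1 - w ^ L) * ((1 - w) ^ 2)⁻¹)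
  rw [offDiagForm_congr (H := fun w => L * (1 - w)⁻¹ + R w) (fun k l hkl => by
      rw [← sum_sum_range_succ_pow (hne k l hkl), Finset.sum_sigma']),
    offDiagForm_add _ R, offDiagForm_const_mul, Complex.add_re, ← Complex.ofReal_natCast,
    Complex.re_ofReal_mul] at hT hT0
  have hR := norm_offDiagForm_le (G := R) (C := 2) (by norm_num) hS (fun k l hkl => by
    have hw : ‖z k * conj (z l)‖ ≤ 1 := by
      rw [norm_mul, Complex.norm_conj]
      exact mul_le_one₀ (hz1 k) (norm_nonneg _) (hz1 l)
    simp only [R]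
    rw [norm_neg, norm_mul, norm_mul, norm_inv, norm_pow]
    gcongr
    nlinarith [norm_one_sub_pow_le hw L, norm_nonneg (1 - (z k * conj (z l)) ^ L)]) a
  have hR' := abs_le.1 ((Complex.abs_re_le_norm _).trans hR)
  have hd0 : 0 ≤ ∑ k, ‖a k‖ ^ 2 * ∑ j ∈ (Finset.range L).sigma fun i => Finset.range (i + 1),
      (‖z k‖ ^ 2) ^ j.2 := by positivity
  have hd1 : ∑ k, ‖a k‖ ^ 2 * ∑ j ∈ (Finset.range L).sigma fun i => Finset.range (i + 1),
      (‖z k‖ ^ 2) ^ j.2 ≤ L ^ 2 * ∑ k, ‖a k‖ ^ 2 := by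
    rw [Finset.mul_sum]
    refine Finset.sum_le_sum fun k _ => ?_
    rw [mul_comm]
    gcongr
    rw [Finset.sum_sigma]
    refine (Finset.sum_le_card_nsmul _ _ (L : ℝ) fun i hi => ?_).trans_eq (by simp [sq])
    refine (Finset.sum_le_card_nsmul _ _ 1 fun j _ =>
      pow_le_one₀ (by positivity) (pow_le_one₀ (norm_nonneg _) (hz1 k))).trans ?_
    rw [Finset.card_range, nsmul_one]
    exact_mod_cast Finset.mem_range.1 hi
  constructor <;> linarith [hR'.1, hR'.2]

/-- Exponential sums over nodes in the unit disk deviate from their diagonal contribution by an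
amount independent of the length of summation. -/
lemma abs_sum_norm_sq_sub_diag_le {S E : ℝ} {L : ℕ} (hL : 0 < L)
    (hz0 : ∀ k, z k ≠ 0) (hz1 : ∀ k, ‖z k‖ ≤ 1) (hE0 : 0 ≤ E)
    (hE : ∀ k, 1 ≤ E * (‖z k‖ ^ (L - 1)) ^ 2)
    (hS0 : 0 ≤ S) (hne : ∀ k l, k ≠ l → z k * conj (z l) ≠ 1)
    (hS : ∀ k, ∑ l, (if k = l then 0 else (‖1 - z k * conj (z l)‖ ^ 2)⁻¹) ≤ S)
    (N : ℕ) (a : ι → ℂ) :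
    |∑ n ∈ Finset.range N, ‖∑ k, a k * z k ^ n‖ ^ 2 -
        ∑ k, ‖a k‖ ^ 2 * ∑ n ∈ Finset.range N, (‖z k‖ ^ 2) ^ n| ≤
      (E + 1) * (L + 4 * S / L) * ∑ k, ‖a k‖ ^ 2 := by
  rw [sum_norm_sq_eq_diag_add_offDiagForm (z := z) (Finset.range N) (fun j => j),
    add_sub_cancel_left]
  have h1 : offDiagForm z (fun w => ∑ j ∈ Finset.range N, w ^ j) a =
      offDiagForm z (fun w => (1 - w)⁻¹) a +
        -1 * offDiagForm z (fun w => (1 - w)⁻¹) (fun k => a k * z k ^ N) := by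
    rw [offDiagForm_mul_pow, ← offDiagForm_const_mul, ← offDiagForm_add]
    refine offDiagForm_congr (fun k l hkl => ?_) a
    have hw1 := hne k l hkl
    rw [geom_sum_eq hw1, ← neg_sub 1 (_ ^ N), ← neg_sub 1 (_ * _), neg_div_neg_eq]
    ring
  have haz : ∑ k, ‖a k * z k ^ N‖ ^ 2 ≤ ∑ k, ‖a k‖ ^ 2 := by
    refine Finset.sum_le_sum fun k _ => ?_
    rw [norm_mul, norm_pow]
    gcongr
    exact mul_le_of_le_one_right (norm_nonneg _) (pow_le_one₀ (norm_nonneg _) (hz1 k))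
  obtain ⟨u1, l1⟩ := offDiagForm_inv_one_sub_bounds hz0 hz1 hE hS0 hne hS a
  obtain ⟨u2, l2⟩ := offDiagForm_inv_one_sub_bounds hz0 hz1 hE hS0 hne hS
    (fun k => a k * z k ^ N)
  have c1 := mul_le_mul_of_nonneg_left haz
    (by positivity : 0 ≤ ((L : ℝ) ^ 2 + 4 * S) * E + 2 * S)
  have c2 := mul_le_mul_of_nonneg_left haz (by positivity : 0 ≤ (L : ℝ) ^ 2 + 2 * S)
  have hL' : (0 : ℝ) < L := by exact_mod_cast hL
  rw [h1, Complex.add_re, neg_one_mul, Complex.neg_re, ← sub_eq_add_neg]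
  refine le_of_mul_le_mul_left ?_ hL'
  rw [← abs_of_pos hL', ← abs_mul, abs_of_pos hL', mul_sub]
  have e : L * ((E + 1) * (L + 4 * S / L) * ∑ k, ‖a k‖ ^ 2) =
      (((L : ℝ) ^ 2 + 4 * S) * E + 2 * S) * ∑ k, ‖a k‖ ^ 2 +
        ((L : ℝ) ^ 2 + 2 * S) * ∑ k, ‖a k‖ ^ 2 := by
    field_simp
    ring
  rw [e, abs_le]
  constructor <;> linarith

end OffDiagForm

lemma sum_inv_sq_le_of_pos_separated {ι : Type*} (s : Finset ι) (g : ι → ℝ) {Δ : ℝ} (hΔ : 0 < Δ)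
    (hg : ∀ i ∈ s, Δ ≤ g i) (hsep : ∀ i ∈ s, ∀ j ∈ s, i ≠ j → Δ ≤ |g i - g j|) :
    ∑ i ∈ s, (g i ^ 2)⁻¹ ≤ 2 / Δ ^ 2 := by
  classical
  have hfl : ∀ i ∈ s, (⌊g i / Δ⌋₊ : ℝ) ≤ g i / Δ ∧ g i / Δ < ⌊g i / Δ⌋₊ + 1 := fun i hi =>
    ⟨Nat.floor_le (div_nonneg (hΔ.le.trans (hg i hi)) hΔ.le), Nat.lt_floor_add_one _⟩
  have hone : ∀ i ∈ s, 1 ≤ ⌊g i / Δ⌋₊ := fun i hi => by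
    rw [Nat.one_le_floor_iff, one_le_div hΔ]
    exact hg i hi
  have hinj : Set.InjOn (fun i => ⌊g i / Δ⌋₊) s := by
    intro i hi j hj hij
    by_contra hne
    have h1 := hfl i hi
    have h2 := hfl j hj
    simp only at hij
    rw [hij] at h1
    have h3 : |g i / Δ - g j / Δ| < 1 := by
      rw [abs_lt]
      constructor <;> linarith [h1.1, h1.2, h2.1, h2.2]
    rw [← sub_div, abs_div, abs_of_pos hΔ, div_lt_one hΔ] at h3
    exact absurd (hsep i hi j hj hne) (not_le.2 h3)
  calc ∑ i ∈ s, (g i ^ 2)⁻¹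
      ≤ ∑ i ∈ s, ((⌊g i / Δ⌋₊ : ℝ) ^ 2)⁻¹ * (Δ ^ 2)⁻¹ := by
        refine Finset.sum_le_sum fun i hi => ?_
        have h1 := (le_div_iff₀ hΔ).1 (hfl i hi).1
        have h2 : (0 : ℝ) < ⌊g i / Δ⌋₊ := by exact_mod_cast hone i hi
        rw [← mul_inv, ← mul_pow]
        gcongr
    _ = (∑ m ∈ s.image (fun i => ⌊g i / Δ⌋₊), ((m : ℝ) ^ 2)⁻¹) * (Δ ^ 2)⁻¹ := by
        rw [Finset.sum_image hinj, Finset.sum_mul]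
    _ ≤ (∑ m ∈ Finset.Ioo 0 (s.sup (fun i => ⌊g i / Δ⌋₊) + 1), ((m : ℝ) ^ 2)⁻¹) *
          (Δ ^ 2)⁻¹ := by
        gcongr
        intro m hm
        obtain ⟨i, hi, rfl⟩ := Finset.mem_image.1 hm
        rw [Finset.mem_Ioo]
        exact ⟨hone i hi, Nat.lt_succ_of_le (Finset.le_sup (f := fun i => ⌊g i / Δ⌋₊) hi)⟩
    _ ≤ 2 * (Δ ^ 2)⁻¹ := by
        gcongr
        simpa using sum_Ioo_inv_sq_le (α := ℝ) 0 (s.sup (fun i => ⌊g i / Δ⌋₊) + 1)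
    _ = 2 / Δ ^ 2 := (div_eq_mul_inv _ _).symm

lemma sum_inv_sq_le_of_separated {ι : Type*} (s : Finset ι) (g : ι → ℝ) {Δ : ℝ} (hΔ : 0 < Δ)
    (hg : ∀ i ∈ s, Δ ≤ |g i|) (hsep : ∀ i ∈ s, ∀ j ∈ s, i ≠ j → Δ ≤ |g i - g j|) :
    ∑ i ∈ s, (g i ^ 2)⁻¹ ≤ 4 / Δ ^ 2 := by
  classical
  rw [← Finset.sum_filter_add_sum_filter_not s (fun i => 0 ≤ g i)]
  have h1 := sum_inv_sq_le_of_pos_separated (s.filter fun i => 0 ≤ g i) g hΔ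
    (fun i hi => by
      obtain ⟨hi, h0⟩ := Finset.mem_filter.1 hi
      simpa [abs_of_nonneg h0] using hg i hi)
    (fun i hi j hj => hsep i (Finset.mem_filter.1 hi).1 j (Finset.mem_filter.1 hj).1)
  have h2 := sum_inv_sq_le_of_pos_separated (s.filter fun i => ¬ 0 ≤ g i) (fun i => -g i) hΔ
    (fun i hi => by
      obtain ⟨hi, h0⟩ := Finset.mem_filter.1 hi
      simpa [abs_of_neg (not_le.1 h0)] using hg i hi)
    (fun i hi j hj hij => by
      rw [neg_sub_neg, abs_sub_comm]
      exact hsep i (Finset.mem_filter.1 hi).1 j (Finset.mem_filter.1 hj).1 hij)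
  simp only [neg_sq] at h2
  calc _ ≤ 2 / Δ ^ 2 + 2 / Δ ^ 2 := add_le_add h1 h2
    _ = 4 / Δ ^ 2 := by ring

/-- Distance from `1` to a point of the closed unit disk in terms of its argument. -/
lemma four_mul_sq_le_norm_one_sub_sq {r x : ℝ} (hr : 0 ≤ r) (hx : |x| ≤ 1 / 2) :
    4 * x ^ 2 ≤ ‖1 - (r : ℂ) * Complex.exp (2 * Real.pi * Complex.I * x)‖ ^ 2 := by
  have hs : 4 * x ^ 2 ≤ Real.sin (Real.pi * x) ^ 2 := by
    have h := Real.mul_le_sin (x := Real.pi * |x|) (by positivity)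
      (by nlinarith [Real.pi_pos])
    have h' : 2 / Real.pi * (Real.pi * |x|) = 2 * |x| := by
      field_simp
    rw [h'] at h
    have h2 : Real.sin (Real.pi * |x|) ^ 2 = Real.sin (Real.pi * x) ^ 2 := by
      rcases abs_choice x with h | h <;> rw [h]
      rw [mul_neg, Real.sin_neg, neg_sq]
    rw [← h2, ← sq_abs x]
    nlinarith [abs_nonneg x]
  have hcos : Real.cos (2 * Real.pi * x) = 1 - 2 * Real.sin (Real.pi * x) ^ 2 := by
    rw [mul_assoc, Real.cos_two_mul, Real.cos_sq']
    ring
  have hnorm : ‖1 - (r : ℂ) * Complex.exp (2 * Real.pi * Complex.I * x)‖ ^ 2 =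
      1 - 2 * r * Real.cos (2 * Real.pi * x) + r ^ 2 := by
    have e : (2 * Real.pi * Complex.I * x : ℂ) = ((2 * Real.pi * x : ℝ) : ℂ) * Complex.I := by
      push_cast
      ring
    rw [e, ← Complex.normSq_eq_norm_sq, Complex.normSq_apply]
    simp only [Complex.sub_re, Complex.one_re, Complex.re_ofReal_mul, Complex.sub_im,
      Complex.one_im, Complex.im_ofReal_mul, Complex.exp_ofReal_mul_I_re,
      Complex.exp_ofReal_mul_I_im]
    linear_combination r ^ 2 * Real.sin_sq_add_cos_sq (2 * Real.pi * x)
  rw [hnorm, hcos]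
  set t := Real.sin (Real.pi * x) ^ 2
  have ht0 : 0 ≤ t := sq_nonneg _
  have ht1 : t ≤ 1 := Real.sin_sq_le_one _
  rcases le_total t (1 / 2) with h | h
  · nlinarith [sq_nonneg (r - (1 - 2 * t))]
  · nlinarith [mul_nonneg hr (by linarith : 0 ≤ 2 * t - 1)]

lemma exp_two_pi_mul_I_sub_round (y : ℝ) :
    Complex.exp (2 * Real.pi * Complex.I * (y - round y : ℝ)) =
      Complex.exp (2 * Real.pi * Complex.I * y) := by
  have e : (2 * Real.pi * Complex.I * (y - round y : ℝ) : ℂ) =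
      2 * Real.pi * Complex.I * y - (round y : ℤ) * (2 * Real.pi * Complex.I) := by
    push_cast
    ring
  rw [e, Complex.exp_sub, Complex.exp_int_mul_two_pi_mul_I, div_one]

lemma enorm2_sq {n : ℕ} (v : Fin n → ℂ) : enorm2 v ^ 2 = ∑ i, ‖v i‖ ^ 2 :=
  Real.sq_sqrt (by positivity)

lemma enorm2_vand_mulVec_sq {K : ℕ} (z : Fin K → ℂ) (N : ℕ) (v : Fin K → ℂ) :
    enorm2 ((vand z N).mulVec v) ^ 2 = ∑ n ∈ Finset.range N, ‖∑ k, v k * z k ^ n‖ ^ 2 := by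
  rw [enorm2_sq, ← Fin.sum_univ_eq_sum_range (fun n => ‖∑ k, v k * z k ^ n‖ ^ 2)]
  simp [Matrix.mulVec, dotProduct, vand, mul_comm]

lemma sum_range_exp_pow_bounds {d : ℝ} (hd : 0 ≤ d) (N : ℕ) :
    N - d * (N * (N - 1)) ≤ ∑ n ∈ Finset.range N, (Real.exp (-d) ^ 2) ^ n ∧
      ∑ n ∈ Finset.range N, (Real.exp (-d) ^ 2) ^ n ≤ N := by
  induction N with
  | zero => simp
  | succ N ih =>
    rw [Finset.sum_range_succ]
    have h : (Real.exp (-d) ^ 2) ^ N = Real.exp (-(2 * d * N)) := by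
      rw [← pow_mul, ← Real.exp_nat_mul]
      congr 1
      push_cast
      ring
    have h1 := Real.add_one_le_exp (-(2 * d * N))
    have h2 : Real.exp (-(2 * d * N)) ≤ 1 := Real.exp_le_one_iff.2 (by
      have : 0 ≤ 2 * d * N := by positivity
      linarith)
    rw [h]
    push_cast
    constructor <;> nlinarith [ih.1, ih.2]

/-- The off-diagonal kernel sums for damped nodes with frequencies separated by `Δ` modulo `1`. -/
lemma vandermonde_kernel_bounds {ι : Type*} [Fintype ι] [DecidableEq ι] {r y : ι → ℝ}
    (hr : ∀ k, 0 ≤ r k) {Δ : ℝ} (hΔ : 0 < Δ)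
    (hsep : ∀ (n : ℤ) (k l : ι), k ≠ l → Δ ≤ |y k - y l + n|)
    {w : ι → ι → ℂ}
    (hw : ∀ k l, w k l = (r k * r l : ℝ) *
      Complex.exp (2 * Real.pi * Complex.I * (y k - y l : ℝ))) :
    (∀ k l, k ≠ l → w k l ≠ 1) ∧
      ∀ k, ∑ l, (if k = l then 0 else (‖1 - w k l‖ ^ 2)⁻¹) ≤ 1 / Δ ^ 2 := by
  set x : ι → ι → ℝ := fun k l => y k - y l - round (y k - y l) with hx
  have hxΔ : ∀ k l, k ≠ l → Δ ≤ |x k l| := fun k l hkl => by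
    have := hsep (-round (y k - y l)) k l hkl
    push_cast at this
    rwa [← sub_eq_add_neg] at this
  have hx4 : ∀ k l, 4 * x k l ^ 2 ≤ ‖1 - w k l‖ ^ 2 := fun k l => by
    rw [hw, ← exp_two_pi_mul_I_sub_round]
    exact four_mul_sq_le_norm_one_sub_sq (mul_nonneg (hr k) (hr l)) (abs_sub_round _)
  have hxpos : ∀ k l, k ≠ l → 0 < x k l ^ 2 := fun k l hkl => by
    have := hΔ.trans_le (hxΔ k l hkl)
    exact sq_pos_of_ne_zero (abs_pos.1 this)
  refine ⟨fun k l hkl h => ?_, fun k => ?_⟩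
  · have h1 := hx4 k l
    have h2 := hxpos k l hkl
    rw [h, sub_self, norm_zero] at h1
    linarith
  · rw [← Finset.add_sum_erase _ _ (Finset.mem_univ k), if_pos rfl, zero_add]
    calc ∑ l ∈ Finset.univ.erase k, (if k = l then 0 else (‖1 - w k l‖ ^ 2)⁻¹)
        ≤ ∑ l ∈ Finset.univ.erase k, 4⁻¹ * (x k l ^ 2)⁻¹ := by
          refine Finset.sum_le_sum fun l hl => ?_
          have hkl : k ≠ l := (Finset.ne_of_mem_erase hl).symm
          rw [if_neg hkl, ← mul_inv]
          have := hxpos k l hkl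
          gcongr
          exact hx4 k l
      _ = 4⁻¹ * ∑ l ∈ Finset.univ.erase k, (x k l ^ 2)⁻¹ := by rw [Finset.mul_sum]
      _ ≤ 4⁻¹ * (4 / Δ ^ 2) := by
          gcongr
          refine sum_inv_sq_le_of_separated _ _ hΔ
            (fun l hl => hxΔ k l (Finset.ne_of_mem_erase hl).symm) (fun l _ m _ hlm => ?_)
          have := hsep (round (y k - y m) - round (y k - y l)) m l hlm.symm
          push_cast at this
          convert this using 2
          simp only [hx]
          ring
      _ = 1 / Δ ^ 2 := by ring

/-- Upper bound on the condition number of the Vandermonde matrix with nodes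
`z k = exp (-(d k)) * exp (2 π i (f k) / Fs)` inside the unit disk, stated in the
equivalent vector form: for all unit vectors `u, v`,
`‖V_N v‖₂² ≤ [(N−1 + 84 F_s/(π δ)) / ((N−1)(1 − d_max(N−1)) − 84 F_s/(π δ))] ‖V_N u‖₂²`. -/
theorem vandermonde_condition_number_upper_bound
    (K N : ℕ) (hK : 2 ≤ K) (hN : 2 ≤ N)
    (Fs : ℝ) (hFs : 0 < Fs)
    (d f : Fin K → ℝ) (hd : ∀ k, 0 ≤ d k)
    (hf : ∀ k, 0 ≤ f k ∧ f k < Fs) (hfinj : Function.Injective f)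
    (z : Fin K → ℂ)
    (hz : ∀ k, z k = Real.exp (-(d k)) * Complex.exp (2 * Real.pi * Complex.I * (f k) / Fs))
    (dmax : ℝ) (hdmax : IsGreatest (Set.range d) dmax)
    (δ : ℝ)
    (hδ : IsLeast {x : ℝ | ∃ (n : ℤ) (k l : Fin K), k ≠ l ∧ x = |f k - f l + n * Fs|} δ)
    (hdmax_small : dmax < 1 / ((N : ℝ) - 1))
    (hδ_large : 84 * Fs / (Real.pi * ((N : ℝ) - 1) * (1 - dmax * ((N : ℝ) - 1))) < δ) :
    ∀ u v : Fin K → ℂ, enorm2 u = 1 → enorm2 v = 1 →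
      enorm2 ((vand z N).mulVec v) ^ 2
        ≤ (((N : ℝ) - 1 + 84 * Fs / (Real.pi * δ))
              / (((N : ℝ) - 1) * (1 - dmax * ((N : ℝ) - 1)) - 84 * Fs / (Real.pi * δ)))
            * enorm2 ((vand z N).mulVec u) ^ 2 := by
  set M : ℝ := (N : ℝ) - 1 with hM
  set D : ℝ := 84 * Fs / (Real.pi * δ) with hD
  have hM1 : 1 ≤ M := by
    have : (2 : ℝ) ≤ N := by exact_mod_cast hN
    linarith
  have hM0 : 0 < M := by linarith
  have hdle : ∀ k, d k ≤ dmax := fun k => hdmax.2 ⟨k, rfl⟩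
  have hdmax0 : 0 ≤ dmax := (hd ⟨0, by omega⟩).trans (hdle _)
  have hdM : dmax * M < 1 := (lt_div_iff₀ hM0).1 hdmax_small
  have hq0 : 0 < 1 - dmax * M := by linarith
  have hδ0 : 0 < δ := lt_of_le_of_lt (by positivity) hδ_large
  have hDlt : D < M * (1 - dmax * M) := by
    have hpi := Real.pi_pos
    rw [div_lt_iff₀ (by positivity)] at hδ_large
    rw [hD, div_lt_iff₀ (by positivity)]
    linarith
  have hDM : D < M := by
    have : 0 ≤ dmax * M := by positivity
    nlinarith
  set T : ℝ := Fs / δ with hT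
  have hT0 : 0 < T := by positivity
  have hDT : 26 * T ≤ D := by
    have hpi := Real.pi_lt_d2
    have hpi0 := Real.pi_pos
    have e : D = 84 / Real.pi * T := by
      rw [hD, hT]
      field_simp
    rw [e]
    gcongr
    rw [le_div_iff₀ hpi0]
    linarith
  have hsep : ∀ (n : ℤ) (k l : Fin K), k ≠ l → δ / Fs ≤ |f k / Fs - f l / Fs + n| := by
    intro n k l hkl
    have h := hδ.2 ⟨n, k, l, hkl, rfl⟩
    have e : f k / Fs - f l / Fs + n = (f k - f l + n * Fs) / Fs := by
      field_simp
    rw [e, abs_div, abs_of_pos hFs]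
    gcongr
  have hT2 : 2 ≤ T := by
    set y := f ⟨0, by omega⟩ / Fs - f ⟨1, by omega⟩ / Fs
    have h1 := hsep (-round y) ⟨0, by omega⟩ ⟨1, by omega⟩ (by simp)
    push_cast at h1
    have h2 := h1.trans (abs_sub_round y)
    rw [div_le_div_iff₀ hFs two_pos] at h2
    rw [hT, le_div_iff₀ hδ0]
    linarith
  obtain ⟨hne, hS⟩ := vandermonde_kernel_bounds (r := fun k => Real.exp (-(d k)))
    (y := fun k => f k / Fs) (fun k => (Real.exp_pos _).le) (div_pos hδ0 hFs) hsep
    (w := fun k l => z k * (starRingEnd ℂ) (z l)) (fun k l => by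
      have e : ((f k / Fs - f l / Fs : ℝ) : ℂ) = f k / Fs - f l / Fs := by push_cast; ring
      rw [hz, hz, map_mul, Complex.conj_ofReal, ← Complex.exp_conj, e, mul_sub, sub_eq_add_neg,
        Complex.exp_add]
      simp only [map_mul, map_div₀, Complex.conj_ofReal, Complex.conj_I, map_ofNat]
      rw [show (2 * Real.pi * -Complex.I * f l / Fs : ℂ) =
        -(2 * Real.pi * Complex.I * (f l / Fs)) by ring]
      push_cast
      ring_nf)
  have hST : 1 / (δ / Fs) ^ 2 = T ^ 2 := by
    rw [hT]
    field_simp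
  rw [hST] at hS
  have hznorm : ∀ k, ‖z k‖ = Real.exp (-(d k)) := by
    intro k
    have e : (2 * Real.pi * Complex.I * f k / Fs : ℂ) =
        ((2 * Real.pi * f k / Fs : ℝ) : ℂ) * Complex.I := by
      push_cast
      ring
    rw [hz, e, norm_mul, Complex.norm_exp_ofReal_mul_I, mul_one, Complex.norm_real,
      Real.norm_of_nonneg (Real.exp_pos _).le]
  set L := ⌈T⌉₊ with hL
  have hLpos : 0 < L := Nat.ceil_pos.2 hT0
  have hTL : T ≤ L := Nat.le_ceil T
  have hLT : (L : ℝ) < T + 1 := Nat.ceil_lt_add_one hT0.le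
  have hE : ∀ k, 1 ≤ 3 * (‖z k‖ ^ (L - 1)) ^ 2 := by
    intro k
    have hexp : (‖z k‖ ^ (L - 1)) ^ 2 = Real.exp (-(2 * (d k * (L - 1)))) := by
      rw [hznorm, ← pow_mul, ← Real.exp_nat_mul]
      congr 1
      push_cast [Nat.cast_sub (Nat.one_le_iff_ne_zero.2 hLpos.ne')]
      ring
    have h1 : d k * (L - 1) ≤ dmax * T :=
      mul_le_mul (hdle k) (by linarith) (by linarith) hdmax0
    have h2 : dmax * (26 * T) ≤ dmax * M := by
      gcongr
      linarith
    have h3 : Real.exp (-1) ≤ Real.exp (-(2 * (d k * (L - 1)))) := Real.exp_le_exp.2 (by linarith)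
    have h4 : 1 ≤ 3 * Real.exp (-1) := by
      rw [Real.exp_neg, ← div_eq_mul_inv, one_le_div (Real.exp_pos 1)]
      exact Real.exp_one_lt_three.le
    rw [hexp]
    linarith
  have hC : ((3 : ℝ) + 1) * (L + 4 * T ^ 2 / L) ≤ 22 * T := by
    have : T ^ 2 / L ≤ T := by
      rw [div_le_iff₀ (by exact_mod_cast hLpos), sq]
      gcongr
    rw [mul_div_assoc]
    linarith
  have hbounds : ∀ a : Fin K → ℂ, enorm2 a = 1 →
      M * (1 - dmax * M) - D ≤ enorm2 ((vand z N).mulVec a) ^ 2 ∧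
        enorm2 ((vand z N).mulVec a) ^ 2 ≤ M + D := by
    intro a ha
    have ha1 : ∑ k, ‖a k‖ ^ 2 = 1 := by rw [← enorm2_sq, ha, one_pow]
    have h := abs_sum_norm_sq_sub_diag_le hLpos (fun k => norm_pos_iff.1 (by
      rw [hznorm]
      exact Real.exp_pos _)) (fun k => by
        rw [hznorm, Real.exp_le_one_iff]
        linarith [hd k]) (by norm_num) hE (by positivity) hne hS N a
    rw [← enorm2_vand_mulVec_sq, ha1, mul_one] at h
    have h' := abs_le.1 (h.trans hC)
    have hup : ∑ k, ‖a k‖ ^ 2 * ∑ n ∈ Finset.range N, (‖z k‖ ^ 2) ^ n ≤ N := by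
      calc _ ≤ ∑ k, ‖a k‖ ^ 2 * (N : ℝ) := by
            gcongr with k
            rw [hznorm]
            exact (sum_range_exp_pow_bounds (hd k) N).2
        _ = N := by rw [← Finset.sum_mul, ha1, one_mul]
    have hlow : N - dmax * (N * M) ≤
        ∑ k, ‖a k‖ ^ 2 * ∑ n ∈ Finset.range N, (‖z k‖ ^ 2) ^ n := by
      calc N - dmax * (N * M) = ∑ k, ‖a k‖ ^ 2 * (N - dmax * (N * M)) := by
            rw [← Finset.sum_mul, ha1, one_mul]
        _ ≤ _ := by
            gcongr with k
            rw [hznorm]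
            refine le_trans ?_ (sum_range_exp_pow_bounds (hd k) N).1
            gcongr
            exact hdle k
    have hN1 : (N : ℝ) = M + 1 := by rw [hM]; ring
    rw [hN1] at hup hlow
    constructor <;> nlinarith [h'.1, h'.2]
  intro u v hu hv
  have hden : 0 < M * (1 - dmax * M) - D := by linarith
  have hnum : 0 ≤ M + D := by linarith
  calc enorm2 ((vand z N).mulVec v) ^ 2 ≤ M + D := (hbounds v hv).2
    _ = (M + D) / (M * (1 - dmax * M) - D) * (M * (1 - dmax * M) - D) :=
        (div_mul_cancel₀ _ hden.ne').symm
    _ ≤ _ := by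
        gcongr
        exact (hbounds u hu).1
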